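/- There is no chiral polytope with flat, finite, regular facets and finite regular vertex-figures. Precisely: if P is a chiral n-polytope (n ≥ 3) all of whose facets are finite regular (n−1)-polytopes that are flat, then the vertex-figures of P cannot all be finite regular (n−1)-polytopes. -/

import Mathlib

open scoped Classical

/-- An abstract polytope of rank `n`: a partially ordered set with a unique minimal
element (of rank `-1`) and a unique maximal element (of rank `n`), all of whose
maximal chains (flags) have exactly `n + 2` elements, equipped with the induced
rank function, satisfying the diamond condition and strong connectivity. -/
structure AbstractPolytope (n : ℕ) where
  Face : Type
  [instPartialOrder : PartialOrder Face]
  rank : Face → ℤ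
  bot : Face
  top : Face
  bot_le : ∀ F : Face, bot ≤ F
  le_top : ∀ F : Face, F ≤ top
  rank_bot : rank bot = -1
  rank_top : rank top = n
  rank_strictMono : ∀ F G : Face, F < G → rank F < rank G
  flag_card : ∀ Φ : Flag Face, Nat.card Φ = n + 2
  flag_ranks : ∀ (Φ : Flag Face) (j : ℤ), -1 ≤ j → j ≤ (n : ℤ) →
    ∃ F ∈ Φ, rank F = j
  diamond : ∀ F G : Face, F < G → rank G = rank F + 2 →
    Nat.card {H : Face // F < H ∧ H < G} = 2
  strongly_connected : ∀ F G : Face, F < G → rank F + 3 ≤ rank G →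
    ∀ H H' : Face, F < H → H < G → F < H' → H' < G →
    Relation.ReflTransGen
      (fun A B : Face => F < A ∧ A < G ∧ F < B ∧ B < G ∧ (A ≤ B ∨ B ≤ A)) H H'

attribute [instance] AbstractPolytope.instPartialOrder

namespace AbstractPolytope

variable {n : ℕ} (P : AbstractPolytope n)

/-- The number of flags of `P`. -/
noncomputable def numFlags : ℕ := Nat.card (Flag P.Face)

/-- A vertex is a face of rank `0`. -/
def IsVertex (F : P.Face) : Prop := P.rank F = 0

/-- A facet is a face of rank `n - 1`. -/
def IsFacet (F : P.Face) : Prop := P.rank F = (n : ℤ) - 1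

/-- The number of vertices of `P`. -/
noncomputable def numVertices : ℕ := Nat.card {F : P.Face // P.IsVertex F}

/-- The number of facets of `P`. -/
noncomputable def numFacets : ℕ := Nat.card {F : P.Face // P.IsFacet F}

/-- Two faces are incident when they are comparable. -/
def Incident (F G : P.Face) : Prop := F ≤ G ∨ G ≤ F

/-- `P` is `(k, m)`-flat when every face of rank `k` is incident with every face of
rank `m`. -/
def IsKMFlat (k m : ℤ) : Prop :=
  ∀ F G : P.Face, P.rank F = k → P.rank G = m → P.Incident F G

/-- `P` is flat when every vertex is incident with every facet. -/
def IsFlat : Prop := P.IsKMFlat 0 ((n : ℤ) - 1)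

/-- Two flags are adjacent when they differ in exactly one element. -/
def AdjacentFlags (Φ Ψ : Flag P.Face) : Prop :=
  Φ ≠ Ψ ∧ ((Φ : Set P.Face) \ (Ψ : Set P.Face)).ncard = 1 ∧
    ((Ψ : Set P.Face) \ (Φ : Set P.Face)).ncard = 1

/-- Two flags lie in the same orbit of the automorphism group `Γ(P)` (the group of
order automorphisms of `P`). -/
def SameOrbit (Φ Ψ : Flag P.Face) : Prop :=
  ∃ f : P.Face ≃o P.Face, f '' (Φ : Set P.Face) = (Ψ : Set P.Face)

/-- `P` is regular when `Γ(P)` is transitive on flags. -/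
def IsRegular : Prop := ∀ Φ Ψ : Flag P.Face, P.SameOrbit Φ Ψ

/-- `P` is chiral when its flags fall into exactly two orbits under `Γ(P)` and
adjacent flags always lie in different orbits. -/
def IsChiral : Prop :=
  (∃ Φ₁ Φ₂ : Flag P.Face, ¬ P.SameOrbit Φ₁ Φ₂ ∧
      ∀ Φ : Flag P.Face, P.SameOrbit Φ Φ₁ ∨ P.SameOrbit Φ Φ₂) ∧
  ∀ Φ Ψ : Flag P.Face, P.AdjacentFlags Φ Ψ → ¬ P.SameOrbit Φ Ψ

/-- The polytope `Q` is (isomorphic to) the section `G/F` of `P`: there is an order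
isomorphism from `Q` onto the interval `[F, G]` of `P`, shifting ranks by
`rank F + 1`. -/
def IsSection {m : ℕ} (Q : AbstractPolytope m) (F G : P.Face) : Prop :=
  F ≤ G ∧ ∃ e : Q.Face ≃o (Set.Icc F G),
    ∀ x : Q.Face, P.rank (e x : P.Face) = Q.rank x + P.rank F + 1

/-- `P` is equivelar of Schläfli type `{p 1, …, p (n-1)}`: every section between a
face of rank `i - 2` and a face of rank `i + 1` is a polygon with exactly `p i`
vertices (i.e. it contains exactly `p i` faces of rank `i - 1`). -/
def IsSchlafli (p : ℕ → ℕ) : Prop :=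
  ∀ i : ℕ, 1 ≤ i → i ≤ n - 1 →
    ∀ F G : P.Face, F < G → P.rank F = (i : ℤ) - 2 → P.rank G = (i : ℤ) + 1 →
      Nat.card {H : P.Face // F < H ∧ H < G ∧ P.rank H = (i : ℤ) - 1} = p i

/-- `P` is tight of type `{p 1, …, p (n-1)}`: it is equivelar of that type and has
exactly `2 p₁ ⋯ p_{n-1}` flags. -/
def IsTight (p : ℕ → ℕ) : Prop :=
  P.IsSchlafli p ∧ P.numFlags = 2 * ∏ i ∈ Finset.Icc 1 (n - 1), p i

end AbstractPolytope
namespace AbstractPolytope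

section Basics

variable {n : ℕ} (P : AbstractPolytope n)

theorem rank_mono {F G : P.Face} (h : F ≤ G) : P.rank F ≤ P.rank G := by
  rcases eq_or_lt_of_le h with rfl | h
  · exact le_rfl
  · exact (P.rank_strictMono _ _ h).le

theorem eq_of_le_rank {F G : P.Face} (h : F ≤ G) (hr : P.rank G ≤ P.rank F) : F = G := by
  rcases eq_or_lt_of_le h with rfl | h
  · rfl
  · have := P.rank_strictMono _ _ h
    omega

theorem lt_of_le_rank {F G : P.Face} (h : F ≤ G) (hr : P.rank F < P.rank G) : F < G :=
  lt_of_le_of_ne h (by rintro rfl; omega)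

/-- A flag of the section `B/A`, as a set of faces of `P`. -/
structure IsFl (A B : P.Face) (c : Set P.Face) : Prop where
  left : A ∈ c
  right : B ∈ c
  sub : ∀ x ∈ c, A ≤ x ∧ x ≤ B
  chain : ∀ x ∈ c, ∀ y ∈ c, x ≤ y ∨ y ≤ x
  ranks : ∀ j, P.rank A ≤ j → j ≤ P.rank B → ∃ x ∈ c, P.rank x = j

variable {P}

theorem IsFl.le {A B : P.Face} {c : Set P.Face} (h : P.IsFl A B c) {x y : P.Face}
    (hx : x ∈ c) (hy : y ∈ c) (hr : P.rank x ≤ P.rank y) : x ≤ y := by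
  rcases h.chain x hx y hy with h1 | h1
  · exact h1
  · exact (P.eq_of_le_rank h1 hr).ge

theorem IsFl.eq {A B : P.Face} {c : Set P.Face} (h : P.IsFl A B c) {x y : P.Face}
    (hx : x ∈ c) (hy : y ∈ c) (hr : P.rank x = P.rank y) : x = y :=
  le_antisymm (h.le hx hy hr.le) (h.le hy hx hr.ge)

theorem IsFl.lt {A B : P.Face} {c : Set P.Face} (h : P.IsFl A B c) {x y : P.Face}
    (hx : x ∈ c) (hy : y ∈ c) (hr : P.rank x < P.rank y) : x < y :=
  P.lt_of_le_rank (h.le hx hy hr.le) hr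

theorem IsFl.restrict {A B : P.Face} {c : Set P.Face} (h : P.IsFl A B c) {A' B' : P.Face}
    (hA : A' ∈ c) (hB : B' ∈ c) (hAB : A' ≤ B') : P.IsFl A' B' (c ∩ Set.Icc A' B') where
  left := ⟨hA, le_rfl, hAB⟩
  right := ⟨hB, hAB, le_rfl⟩
  sub := fun x hx => hx.2
  chain := fun x hx y hy => h.chain x hx.1 y hy.1
  ranks := by
    intro j h1 h2
    have hA1 := P.rank_mono (h.sub _ hA).1
    have hB1 := P.rank_mono (h.sub _ hB).2
    obtain ⟨x, hx, rfl⟩ := h.ranks j (by omega) (by omega)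
    exact ⟨x, ⟨hx, h.le hA hx h1, h.le hx hB h2⟩, rfl⟩

theorem IsFl.union {A H B : P.Face} {c d : Set P.Face} (h : P.IsFl A H c) (h' : P.IsFl H B d) :
    P.IsFl A B (c ∪ d) where
  left := Or.inl h.left
  right := Or.inr h'.right
  sub := by
    rintro x (hx | hx)
    · exact ⟨(h.sub x hx).1, (h.sub x hx).2.trans (h'.sub _ h'.left).2⟩
    · exact ⟨(h.sub _ h.left).2.trans (h'.sub _ hx).1, (h'.sub _ hx).2⟩
  chain := by
    rintro x (hx | hx) y (hy | hy)
    · exact h.chain x hx y hy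
    · exact Or.inl ((h.sub x hx).2.trans (h'.sub y hy).1)
    · exact Or.inr ((h.sub y hy).2.trans (h'.sub x hx).1)
    · exact h'.chain x hx y hy
  ranks := by
    intro j h1 h2
    rcases le_total j (P.rank H) with h3 | h3
    · obtain ⟨x, hx, e⟩ := h.ranks j h1 h3
      exact ⟨x, Or.inl hx, e⟩
    · obtain ⟨x, hx, e⟩ := h'.ranks j h3 h2
      exact ⟨x, Or.inr hx, e⟩

/-- splitting a flag at one of its elements -/
theorem IsFl.split {A H B : P.Face} {c : Set P.Face} (h : P.IsFl A B c) (hH : H ∈ c) :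
    c = (c ∩ Set.Icc A H) ∪ (c ∩ Set.Icc H B) := by
  ext x
  constructor
  · intro hx
    rcases h.chain x hx H hH with h1 | h1
    · exact Or.inl ⟨hx, (h.sub x hx).1, h1⟩
    · exact Or.inr ⟨hx, h1, (h.sub x hx).2⟩
  · rintro (hx | hx)
    · exact hx.1
    · exact hx.1

theorem IsFl.eq_of_subset {A B : P.Face} {c d : Set P.Face} (h : P.IsFl A B c)
    (h' : P.IsFl A B d) (hs : c ⊆ d) : c = d := by
  refine Set.Subset.antisymm hs fun x hx => ?_
  obtain ⟨y, hy, e⟩ := h.ranks (P.rank x) (P.rank_mono (h'.sub x hx).1)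
    (P.rank_mono (h'.sub x hx).2)
  rwa [← h'.eq (hs hy) hx e]

theorem isFl_flag (Φ : Flag P.Face) : P.IsFl P.bot P.top (Φ : Set P.Face) where
  left := Flag.mem_iff_forall_le_or_ge.2 fun _ _ => Or.inl (P.bot_le _)
  right := Flag.mem_iff_forall_le_or_ge.2 fun _ _ => Or.inr (P.le_top _)
  sub := fun x _ => ⟨P.bot_le x, P.le_top x⟩
  chain := fun x hx y hy => Φ.le_or_le hx hy
  ranks := by
    intro j h1 h2
    rw [P.rank_bot] at h1
    rw [P.rank_top] at h2
    exact P.flag_ranks Φ j h1 h2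

theorem IsFl.isMaxChain {c : Set P.Face} (h : P.IsFl P.bot P.top c) :
    IsMaxChain (· ≤ ·) c := by
  refine ⟨fun x hx y hy _ => h.chain x hx y hy, fun t ht hct => ?_⟩
  refine Set.Subset.antisymm hct fun x hx => ?_
  obtain ⟨y, hy, e⟩ := h.ranks (P.rank x) (P.rank_mono (P.bot_le x))
    (P.rank_mono (P.le_top x))
  rcases ht.total (hct hy) hx with h1 | h1
  · rwa [← P.eq_of_le_rank h1 e.ge]
  · rwa [P.eq_of_le_rank h1 e.le]

/-- The flag associated with a set satisfying `IsFl`. -/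
def IsFl.toFlag {c : Set P.Face} (h : P.IsFl P.bot P.top c) : Flag P.Face :=
  Flag.ofIsMaxChain c h.isMaxChain

theorem IsFl.coe_toFlag {c : Set P.Face} (h : P.IsFl P.bot P.top c) :
    (h.toFlag : Set P.Face) = c := rfl

theorem exists_isFl_of_chain (s : Set P.Face) (hs : IsChain (· ≤ ·) s) :
    ∃ c, P.IsFl P.bot P.top c ∧ s ⊆ c := by
  obtain ⟨Φ, hΦ⟩ := hs.exists_subset_flag
  exact ⟨Φ, isFl_flag Φ, hΦ⟩

theorem exists_isFl {A B : P.Face} (h : A ≤ B) : ∃ c, P.IsFl A B c := by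
  obtain ⟨c, hc, hs⟩ := exists_isFl_of_chain {A, B} (IsChain.pair h)
  exact ⟨_, hc.restrict (hs (by simp)) (hs (by simp)) h⟩

theorem diamond_eq {A B x y z : P.Face} (hr : P.rank B = P.rank A + 2)
    (hx : A < x ∧ x < B) (hy : A < y ∧ y < B) (hz : A < z ∧ z < B)
    (hxy : y ≠ x) (hxz : z ≠ x) : y = z := by
  have h2 := P.diamond A B (hx.1.trans hx.2) hr
  rw [Nat.card_eq_two_iff] at h2
  obtain ⟨a, b, hab, hu⟩ := h2
  have key : ∀ w : {H : P.Face // A < H ∧ H < B}, w = a ∨ w = b := by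
    intro w
    have : w ∈ (Set.univ : Set _) := trivial
    rw [← hu] at this
    simpa using this
  have k1 := key ⟨x, hx⟩
  have k2 := key ⟨y, hy⟩
  have k3 := key ⟨z, hz⟩
  have e1 : (⟨y, hy⟩ : {H : P.Face // A < H ∧ H < B}) ≠ ⟨x, hx⟩ := by simpa using hxy
  have e2 : (⟨z, hz⟩ : {H : P.Face // A < H ∧ H < B}) ≠ ⟨x, hx⟩ := by simpa using hxz
  have : (⟨y, hy⟩ : {H : P.Face // A < H ∧ H < B}) = ⟨z, hz⟩ := by grind
  simpa using this

theorem diamond_exists {A B x : P.Face} (hr : P.rank B = P.rank A + 2)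
    (hx : A < x ∧ x < B) : ∃ y, (A < y ∧ y < B) ∧ y ≠ x := by
  have h2 := P.diamond A B (hx.1.trans hx.2) hr
  rw [Nat.card_eq_two_iff] at h2
  obtain ⟨a, b, hab, hu⟩ := h2
  by_cases h : a.1 = x
  · refine ⟨b.1, b.2, fun h' => hab (Subtype.ext (h.trans h'.symm))⟩
  · exact ⟨a.1, a.2, h⟩

theorem between_rank {A B x : P.Face} (hr : P.rank B = P.rank A + 2)
    (hx : A < x ∧ x < B) : P.rank x = P.rank A + 1 := by
  have := P.rank_strictMono _ _ hx.1
  have := P.rank_strictMono _ _ hx.2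
  omega

/-- Changing a flag in one rank. -/
theorem IsFl.exchange {A B : P.Face} {c : Set P.Face} (h : P.IsFl A B c) {a x b y : P.Face}
    (ha : a ∈ c) (hb : b ∈ c) (hx : x ∈ c) (hr : P.rank b = P.rank a + 2)
    (hax : a < x ∧ x < b) (hay : a < y ∧ y < b) :
    P.IsFl A B (insert y (c \ {x})) := by
  have rx := between_rank hr hax
  have ry := between_rank hr hay
  have cmp : ∀ z ∈ c \ {x}, z ≤ a ∨ b ≤ z := by
    rintro z ⟨hz, hzx⟩
    rcases lt_trichotomy (P.rank z) (P.rank x) with h1 | h1 | h1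
    · exact Or.inl (h.le hz ha (by omega))
    · exact absurd (h.eq hz hx h1) hzx
    · exact Or.inr (h.le hb hz (by omega))
  refine ⟨Or.inr ⟨h.left, ?_⟩, Or.inr ⟨h.right, ?_⟩, ?_, ?_, ?_⟩
  · rintro (e : A = x)
    exact absurd (h.sub a ha).1 (not_le_of_gt (e ▸ hax.1))
  · rintro (e : B = x)
    exact absurd (h.sub b hb).2 (not_le_of_gt (e ▸ hax.2))
  · rintro z (rfl | hz)
    · exact ⟨(h.sub a ha).1.trans hay.1.le, hay.2.le.trans (h.sub b hb).2⟩
    · exact h.sub z hz.1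
  · have key : ∀ z ∈ c \ {x}, z ≤ y ∨ y ≤ z := fun z hz =>
      (cmp z hz).imp (fun h => h.trans hay.1.le) (fun h => hay.2.le.trans h)
    rintro z (rfl | hz) w (rfl | hw)
    · exact Or.inl le_rfl
    · exact (key w hw).symm
    · exact key z hz
    · exact h.chain z hz.1 w hw.1
  · intro j h1 h2
    obtain ⟨z, hz, rfl⟩ := h.ranks j h1 h2
    by_cases e : z = x
    · exact ⟨y, Or.inl rfl, by rw [e]; omega⟩
    · exact ⟨z, Or.inr ⟨hz, e⟩, rfl⟩

/-- Adjacency (or equality) of flags of a section. -/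
def Adj (A B : P.Face) (c d : Set P.Face) : Prop :=
  P.IsFl A B d ∧ ∃ j, ∀ y ∈ c, P.rank y ≠ j → y ∈ d

theorem conn_upper {A H B : P.Face} {c : Set P.Face} (h : P.IsFl A H c) {d d' : Set P.Face}
    (hc : Relation.ReflTransGen (Adj H B) d d') :
    Relation.ReflTransGen (Adj A B) (c ∪ d) (c ∪ d') := by
  induction hc with
  | refl => exact .refl
  | tail _ h2 ih =>
    refine ih.tail ⟨h.union h2.1, ?_⟩
    obtain ⟨j, hj⟩ := h2.2
    refine ⟨j, ?_⟩
    rintro y (hy | hy) hr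
    · exact Or.inl hy
    · exact Or.inr (hj y hy hr)

theorem conn_lower {A H B : P.Face} {c : Set P.Face} (h : P.IsFl H B c) {d d' : Set P.Face}
    (hc : Relation.ReflTransGen (Adj A H) d d') :
    Relation.ReflTransGen (Adj A B) (d ∪ c) (d' ∪ c) := by
  induction hc with
  | refl => exact .refl
  | tail _ h2 ih =>
    refine ih.tail ⟨h2.1.union h, ?_⟩
    obtain ⟨j, hj⟩ := h2.2
    refine ⟨j, ?_⟩
    rintro y (hy | hy) hr
    · exact Or.inl (hj y hy hr)
    · exact Or.inr hy

theorem flag_conn : ∀ (d : ℕ) (A B : P.Face), A ≤ B → P.rank B ≤ P.rank A + d →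
    ∀ c c', P.IsFl A B c → P.IsFl A B c' → Relation.ReflTransGen (Adj A B) c c' := by
  intro d
  induction d with
  | zero =>
    intro A B hAB hr c c' hc hc'
    refine .single ⟨hc', P.rank A, fun y hy hne => ?_⟩
    have h1 := P.rank_mono (hc.sub y hy).1
    have h2 := P.rank_mono (hc.sub y hy).2
    push_cast at hr
    omega
  | succ d ih =>
    intro A B hAB hr c c' hc hc'
    by_cases h3 : P.rank B ≤ P.rank A + 2
    · refine .single ⟨hc', P.rank A + 1, fun y hy hne => ?_⟩
      have h1 := P.rank_mono (hc.sub y hy).1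
      have h2 := P.rank_mono (hc.sub y hy).2
      by_cases e : P.rank y = P.rank A
      · rw [hc.eq hy hc.left e]; exact hc'.left
      · rw [hc.eq hy hc.right (by omega)]; exact hc'.right
    · have hlt : A < B := P.lt_of_le_rank hAB (by omega)
      obtain ⟨H, hH, rH⟩ := hc.ranks (P.rank A + 1) (by omega) (by omega)
      obtain ⟨H', hH', rH'⟩ := hc'.ranks (P.rank A + 1) (by omega) (by omega)
      have s1 := P.strongly_connected A B hlt (by omega) H H'
        (hc.lt hc.left hH (by omega)) (hc.lt hH hc.right (by omega))
        (hc'.lt hc'.left hH' (by omega)) (hc'.lt hH' hc'.right (by omega))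
      -- all flags through a common proper face are connected
      have key : ∀ K : P.Face, A < K → K < B → ∀ e e', P.IsFl A B e → P.IsFl A B e' →
          K ∈ e → K ∈ e' → Relation.ReflTransGen (Adj A B) e e' := by
        intro K hAK hKB e e' he he' hK hK'
        have r1 := P.rank_strictMono _ _ hAK
        have r2 := P.rank_strictMono _ _ hKB
        rw [he.split hK, he'.split hK']
        have c1 := ih A K hAK.le (by push_cast at hr; omega) _ _
          (he.restrict he.left hK hAK.le) (he'.restrict he'.left hK' hAK.le)
        have c2 := ih K B hKB.le (by push_cast at hr; omega) _ _
          (he.restrict hK he.right hKB.le) (he'.restrict hK' he'.right hKB.le)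
        exact (conn_lower (he.restrict hK he.right hKB.le) c1).trans
          (conn_upper (he'.restrict he'.left hK' hAK.le) c2)
      have main : ∀ K, Relation.ReflTransGen
          (fun X Y : P.Face => A < X ∧ X < B ∧ A < Y ∧ Y < B ∧ (X ≤ Y ∨ Y ≤ X)) H K →
          A < K ∧ K < B ∧ ∀ e, P.IsFl A B e → K ∈ e →
            Relation.ReflTransGen (Adj A B) c e := by
        intro K hK
        induction hK with
        | refl =>
          have l1 := hc.lt hc.left hH (by omega)
          have l2 := hc.lt hH hc.right (by omega)
          exact ⟨l1, l2, fun e he hHe => key H l1 l2 _ _ hc he hH hHe⟩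
        | tail _ h2 ih2 =>
          rename_i X Y _
          obtain ⟨a1, a2, a3, a4, a5⟩ := h2
          refine ⟨a3, a4, fun e he hYe => ?_⟩
          have : ∃ f, P.IsFl A B f ∧ X ∈ f ∧ Y ∈ f := by
            rcases a5 with a5 | a5
            · obtain ⟨f1, h1⟩ := exists_isFl a1.le
              obtain ⟨f2, h2⟩ := exists_isFl a5
              obtain ⟨f3, h3⟩ := exists_isFl a4.le
              exact ⟨_, (h1.union h2).union h3, Or.inl (Or.inl h1.right), Or.inr h3.left⟩
            · obtain ⟨f1, h1⟩ := exists_isFl a3.le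
              obtain ⟨f2, h2⟩ := exists_isFl a5
              obtain ⟨f3, h3⟩ := exists_isFl a2.le
              exact ⟨_, (h1.union h2).union h3, Or.inr h3.left, Or.inl (Or.inl h1.right)⟩
          obtain ⟨f, hf, hXf, hYf⟩ := this
          exact (ih2.2.2 f hf hXf).trans (key Y a3 a4 f e hf he hYf hYe)
      have fin := (main H' s1).2.2 c' hc' hH'
      exact fin

/-- An induction principle over flags of a section. -/
theorem flag_induction {A B : P.Face} (hAB : A ≤ B) (p : Set P.Face → Prop)
    {c : Set P.Face} (hc : P.IsFl A B c) (h0 : p c)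
    (step : ∀ d d', P.IsFl A B d → P.IsFl A B d' → p d →
      (∃ j, ∀ y ∈ d, P.rank y ≠ j → y ∈ d') → p d')
    {c' : Set P.Face} (hc' : P.IsFl A B c') : p c' := by
  have h := flag_conn (P.rank B - P.rank A).toNat A B hAB (by omega) c c' hc hc'
  have : P.IsFl A B c' ∧ p c' := by
    clear hc'
    induction h with
    | refl => exact ⟨hc, h0⟩
    | tail _ h2 ih => exact ⟨h2.1, step _ _ ih.1 h2.1 ih.2 h2.2⟩
  exact this.2

/-- Rank preserving partial isomorphisms defined on the section `B/A`. -/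
structure IsoOn (φ : P.Face → P.Face) (A B : P.Face) : Prop where
  lt : ∀ x y, A ≤ x → y ≤ B → x < y → φ x < φ y
  inj : ∀ x y, A ≤ x → x ≤ B → A ≤ y → y ≤ B → φ x = φ y → x = y
  rank : ∀ x, A ≤ x → x ≤ B → P.rank (φ x) = P.rank x

theorem IsoOn.mono {φ : P.Face → P.Face} {A B A' B' : P.Face} (h : IsoOn φ A B)
    (hA : A ≤ A') (hB : B' ≤ B) : IsoOn φ A' B' where
  lt := fun x y h1 h2 h3 => h.lt x y (hA.trans h1) (h2.trans hB) h3
  inj := fun x y h1 h2 h3 h4 => h.inj x y (hA.trans h1) (h2.trans hB) (hA.trans h3) (h4.trans hB)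
  rank := fun x h1 h2 => h.rank x (hA.trans h1) (h2.trans hB)

theorem IsoOn.le {φ : P.Face → P.Face} {A B : P.Face} (h : IsoOn φ A B) {x y : P.Face}
    (hx : A ≤ x) (hy : y ≤ B) (hxy : x ≤ y) : φ x ≤ φ y := by
  rcases eq_or_lt_of_le hxy with rfl | h1
  · exact le_rfl
  · exact (h.lt x y hx hy h1).le

theorem IsoOn.comp {φ ψ : P.Face → P.Face} {A B A' B' : P.Face} (h' : IsoOn ψ A' B')
    (h : IsoOn φ A B) (hA : A' ≤ φ A) (hB : φ B ≤ B') : IsoOn (fun x => ψ (φ x)) A B where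
  lt := fun x y h1 h2 h3 => h'.lt _ _ (hA.trans (h.le le_rfl (h3.le.trans h2) h1))
    ((h.le (h1.trans h3.le) le_rfl h2).trans hB) (h.lt x y h1 h2 h3)
  inj := fun x y h1 h2 h3 h4 e => h.inj x y h1 h2 h3 h4
    (h'.inj _ _ (hA.trans (h.le le_rfl h2 h1)) ((h.le h1 le_rfl h2).trans hB)
      (hA.trans (h.le le_rfl h4 h3)) ((h.le h3 le_rfl h4).trans hB) e)
  rank := fun x h1 h2 => by
    rw [h'.rank _ (hA.trans (h.le le_rfl h2 h1)) ((h.le h1 le_rfl h2).trans hB), h.rank x h1 h2]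

theorem isoOn_id (A B : P.Face) : IsoOn (fun x => x) A B :=
  ⟨fun _ _ _ _ h => h, fun _ _ _ _ _ _ h => h, fun _ _ _ => rfl⟩

/-- Rigidity. -/
theorem IsoOn.rigid {φ ψ : P.Face → P.Face} {A B : P.Face} (hφ : IsoOn φ A B)
    (hψ : IsoOn ψ A B) {c : Set P.Face} (hc : P.IsFl A B c) (h : ∀ x ∈ c, φ x = ψ x) :
    ∀ x, A ≤ x → x ≤ B → φ x = ψ x := by
  intro x hAx hxB
  obtain ⟨d1, hd1⟩ := exists_isFl hAx
  obtain ⟨d2, hd2⟩ := exists_isFl hxB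
  refine flag_induction (hAx.trans hxB) (fun d => ∀ x ∈ d, φ x = ψ x) hc h ?_
    (hd1.union hd2) x (Or.inl hd1.right)
  rintro d d' hd hd' ih ⟨j, hj⟩ y hy
  obtain ⟨y0, hy0, e0⟩ := hd.ranks (P.rank y) (P.rank_mono (hd'.sub y hy).1)
    (P.rank_mono (hd'.sub y hy).2)
  by_cases e : P.rank y0 = j
  swap
  · rw [← hd'.eq (hj y0 hy0 e) hy e0]
    exact ih y0 hy0
  by_cases hne : y = y0
  · rw [hne]; exact ih y0 hy0
  have rA : P.rank A < P.rank y := by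
    rcases eq_or_lt_of_le (P.rank_mono (hd'.sub y hy).1) with h1 | h1
    · exact absurd ((hd'.eq hd'.left hy h1).symm.trans (hd.eq hd.left hy0 (by omega))) hne
    · exact h1
  have rB : P.rank y < P.rank B := by
    rcases eq_or_lt_of_le (P.rank_mono (hd'.sub y hy).2) with h1 | h1
    · exact absurd ((hd'.eq hy hd'.right h1).trans (hd.eq hy0 hd.right (by omega)).symm) hne
    · exact h1
  obtain ⟨a, ha, ra⟩ := hd.ranks (P.rank y - 1) (by omega) (by omega)
  obtain ⟨b, hb, rb⟩ := hd.ranks (P.rank y + 1) (by omega) (by omega)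
  have ha' := hj a ha (by omega)
  have hb' := hj b hb (by omega)
  have l1 := hd'.lt ha' hy (by omega)
  have l2 := hd'.lt hy hb' (by omega)
  have l3 := hd.lt ha hy0 (by omega)
  have l4 := hd.lt hy0 hb (by omega)
  have sa := hd.sub a ha
  have sb := hd.sub b hb
  have sy := hd'.sub y hy
  have sy0 := hd.sub y0 hy0
  refine diamond_eq (A := φ a) (B := φ b) (x := φ y0) ?_ ?_ ?_ ?_ ?_ ?_
  · rw [hφ.rank a sa.1 sa.2, hφ.rank b sb.1 sb.2]; omega
  · exact ⟨hφ.lt _ _ sa.1 sy0.2 l3, hφ.lt _ _ sy0.1 sb.2 l4⟩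
  · exact ⟨hφ.lt _ _ sa.1 sy.2 l1, hφ.lt _ _ sy.1 sb.2 l2⟩
  · rw [ih a ha, ih b hb]
    exact ⟨hψ.lt _ _ sa.1 sy.2 l1, hψ.lt _ _ sy.1 sb.2 l2⟩
  · exact fun e => hne (hφ.inj _ _ sy.1 sy.2 sy0.1 sy0.2 e)
  · rw [ih y0 hy0]
    exact fun e => hne (hψ.inj _ _ sy.1 sy.2 sy0.1 sy0.2 e)

/-- Automorphisms preserve rank. -/
theorem rank_le_of_strictMono (f : P.Face → P.Face) (hf : StrictMono f) :
    ∀ (k : ℕ) (x : P.Face), P.rank x = -1 + k → P.rank x ≤ P.rank (f x) := by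
  intro k
  induction k with
  | zero =>
    intro x hx
    have := P.rank_mono (P.bot_le (f x))
    rw [P.rank_bot] at this
    push_cast at hx
    omega
  | succ k ih =>
    intro x hx
    obtain ⟨c, hc⟩ := exists_isFl (P.bot_le x)
    push_cast at hx
    obtain ⟨y, hy, ry⟩ := hc.ranks (-1 + k) (by rw [P.rank_bot]; omega) (by omega)
    have := ih y ry
    have := P.rank_strictMono _ _ (hf (hc.lt hy hc.right (by omega)))
    omega

theorem rank_aut (f : P.Face ≃o P.Face) (x : P.Face) : P.rank (f x) = P.rank x := by
  have h1 : ∀ (g : P.Face ≃o P.Face) (y : P.Face), P.rank y ≤ P.rank (g y) := by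
    intro g y
    have := P.rank_mono (P.bot_le y)
    rw [P.rank_bot] at this
    exact rank_le_of_strictMono g g.strictMono (P.rank y + 1).toNat y (by omega)
  have h2 := h1 f.symm (f x)
  rw [f.symm_apply_apply] at h2
  exact le_antisymm h2 (h1 f x)

theorem isoOn_aut (f : P.Face ≃o P.Face) (A B : P.Face) : IsoOn f A B :=
  ⟨fun _ _ _ _ h => f.strictMono h, fun _ _ _ _ _ _ h => f.injective h, fun x _ _ => rank_aut f x⟩

theorem aut_bot (f : P.Face ≃o P.Face) : f P.bot = P.bot :=
  le_antisymm (by simpa using f.monotone (P.bot_le (f.symm P.bot))) (P.bot_le _)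

theorem aut_top (f : P.Face ≃o P.Face) : f P.top = P.top :=
  le_antisymm (P.le_top _) (by simpa using f.monotone (P.le_top (f.symm P.top)))

end Basics

end AbstractPolytope
namespace AbstractPolytope

section Sections

variable {n : ℕ} {P : AbstractPolytope n}

theorem isFl_section_flag {A B : P.Face} (hAB : A ≤ B) (Φ : Flag (Set.Icc A B)) :
    P.IsFl A B (Subtype.val '' (Φ : Set (Set.Icc A B))) := by
  have hA : (⟨A, le_rfl, hAB⟩ : Set.Icc A B) ∈ Φ :=
    Flag.mem_iff_forall_le_or_ge.2 fun b _ => Or.inl b.2.1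
  have hB : (⟨B, hAB, le_rfl⟩ : Set.Icc A B) ∈ Φ :=
    Flag.mem_iff_forall_le_or_ge.2 fun b _ => Or.inr b.2.2
  have hch : IsChain (· ≤ ·) (Subtype.val '' (Φ : Set (Set.Icc A B))) := by
    rintro _ ⟨x, hx, rfl⟩ _ ⟨y, hy, rfl⟩ _
    exact Φ.le_or_le hx hy
  obtain ⟨c, hc, hs⟩ := exists_isFl_of_chain _ hch
  have h1 := hc.restrict (hs ⟨_, hA, rfl⟩) (hs ⟨_, hB, rfl⟩) hAB
  have e : Subtype.val '' (Φ : Set (Set.Icc A B)) = c ∩ Set.Icc A B := by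
    refine Set.Subset.antisymm ?_ ?_
    · rintro _ ⟨x, hx, rfl⟩
      exact ⟨hs ⟨x, hx, rfl⟩, x.2⟩
    · rintro x ⟨hx, hx'⟩
      refine ⟨⟨x, hx'⟩, ?_, rfl⟩
      refine Flag.mem_iff_forall_le_or_ge.2 fun b hb => ?_
      exact hc.chain x hx b (hs ⟨b, hb, rfl⟩)
  rw [e]
  exact h1

theorem IsFl.isMaxChain_section {A B : P.Face} {c : Set P.Face} (h : P.IsFl A B c) :
    IsMaxChain (· ≤ ·) (Subtype.val ⁻¹' c : Set (Set.Icc A B)) := by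
  refine ⟨fun x hx y hy _ => h.chain x hx y hy, fun t ht hct => ?_⟩
  refine Set.Subset.antisymm hct fun x hx => ?_
  obtain ⟨y, hy, e⟩ := h.ranks (P.rank x) (P.rank_mono x.2.1) (P.rank_mono x.2.2)
  have hy' : (⟨y, h.sub y hy⟩ : Set.Icc A B) ∈ t := hct hy
  change x.1 ∈ c
  rcases ht.total hy' hx with h1 | h1
  · rwa [← P.eq_of_le_rank (F := y) (G := x) h1 e.ge]
  · rwa [P.eq_of_le_rank (F := x) (G := y) h1 e.le]

theorem IsFl.card {A B : P.Face} {c : Set P.Face} (h : P.IsFl A B c) :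
    Nat.card c = (P.rank B + 1 - P.rank A).toNat := by
  have e : c ≃ Set.Icc (P.rank A) (P.rank B) := by
    refine Equiv.ofBijective
      (fun x => ⟨P.rank x.1, P.rank_mono (h.sub _ x.2).1, P.rank_mono (h.sub _ x.2).2⟩) ⟨?_, ?_⟩
    · intro x y hxy
      exact Subtype.ext (h.eq x.2 y.2 (congrArg Subtype.val hxy))
    · rintro ⟨j, hj1, hj2⟩
      obtain ⟨x, hx, e⟩ := h.ranks j hj1 hj2
      exact ⟨⟨x, hx⟩, Subtype.ext e⟩
  rw [Nat.card_congr e]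
  simp

/-- The section `B/A` as a polytope. -/
def sec (A B : P.Face) (m : ℕ) (hAB : A ≤ B) (hr : P.rank B = P.rank A + m + 1) :
    AbstractPolytope m where
  Face := Set.Icc A B
  rank := fun x => P.rank x.1 - P.rank A - 1
  bot := ⟨A, le_rfl, hAB⟩
  top := ⟨B, hAB, le_rfl⟩
  bot_le := fun x => x.2.1
  le_top := fun x => x.2.2
  rank_bot := by simp
  rank_top := by
    change P.rank B - P.rank A - 1 = m
    omega
  rank_strictMono := fun F G h => by
    have := P.rank_strictMono F.1 G.1 h
    omega
  flag_card := fun Φ => by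
    have h1 := (isFl_section_flag hAB Φ).card
    have h2 : Nat.card (Subtype.val '' (Φ : Set (Set.Icc A B))) = Nat.card Φ :=
      Nat.card_image_of_injective Subtype.val_injective _
    rw [← h2, h1]
    omega
  flag_ranks := fun Φ j h1 h2 => by
    obtain ⟨_, ⟨x, hx, rfl⟩, e⟩ := (isFl_section_flag hAB Φ).ranks (j + P.rank A + 1)
      (by omega) (by omega)
    exact ⟨x, hx, by omega⟩
  diamond := fun F G h hr => by
    rw [← P.diamond F.1 G.1 h (by omega)]
    refine Nat.card_congr ⟨fun H => ⟨H.1.1, H.2.1, H.2.2⟩,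
      fun H => ⟨⟨H.1, F.2.1.trans H.2.1.le, H.2.2.le.trans G.2.2⟩, H.2.1, H.2.2⟩, ?_, ?_⟩
    · intro x; rfl
    · intro x; rfl
  strongly_connected := fun F G h hr H H' h1 h2 h3 h4 => by
    have key := P.strongly_connected F.1 G.1 h (by omega) H.1 H'.1 h1 h2 h3 h4
    have aux : ∀ K : P.Face, Relation.ReflTransGen
        (fun X Y : P.Face => F.1 < X ∧ X < G.1 ∧ F.1 < Y ∧ Y < G.1 ∧ (X ≤ Y ∨ Y ≤ X)) H.1 K →
        ∀ hK : K ∈ Set.Icc A B, Relation.ReflTransGen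
          (fun X Y : Set.Icc A B => F < X ∧ X < G ∧ F < Y ∧ Y < G ∧ (X ≤ Y ∨ Y ≤ X))
          H ⟨K, hK⟩ := by
      intro K hK
      induction hK with
      | refl => intro _; exact .refl
      | tail _ h2 ih =>
        intro hK
        exact (ih ⟨F.2.1.trans h2.1.le, h2.2.1.le.trans G.2.2⟩).tail h2
    exact aux H'.1 key H'.2

theorem isSection_sec (A B : P.Face) (m : ℕ) (hAB : A ≤ B) (hr : P.rank B = P.rank A + m + 1) :
    P.IsSection (sec A B m hAB hr) A B := by
  refine ⟨hAB, OrderIso.refl (Set.Icc A B), fun x => ?_⟩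
  change P.rank x.1 = (P.rank x.1 - P.rank A - 1) + P.rank A + 1
  omega

theorem exists_isoOn_of_regular (A B : P.Face) (m : ℕ) (hAB : A ≤ B)
    (hr : P.rank B = P.rank A + m + 1) (hreg : (sec A B m hAB hr).IsRegular)
    {c d : Set P.Face} (hc : P.IsFl A B c) (hd : P.IsFl A B d) :
    ∃ φ : P.Face → P.Face, IsoOn φ A B ∧ (∀ x, A ≤ x → x ≤ B → A ≤ φ x ∧ φ x ≤ B) ∧
      ∀ x ∈ c, φ x ∈ d := by
  obtain ⟨f, hf⟩ := hreg (Flag.ofIsMaxChain _ hc.isMaxChain_section)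
    (Flag.ofIsMaxChain _ hd.isMaxChain_section)
  have hrk : ∀ x : Set.Icc A B, P.rank (f x).1 = P.rank x.1 := by
    intro x
    have h1 : P.rank (f x).1 - P.rank A - 1 = P.rank x.1 - P.rank A - 1 :=
      rank_aut (P := sec A B m hAB hr) f x
    omega
  let φ : P.Face → P.Face := fun x => if h : x ∈ Set.Icc A B then (f ⟨x, h⟩).1 else x
  have hφ : ∀ x (h : x ∈ Set.Icc A B), φ x = (f ⟨x, h⟩).1 := fun x h => dif_pos h
  refine ⟨φ, ⟨?_, ?_, ?_⟩, ?_, ?_⟩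
  · intro x y h1 h2 h3
    rw [hφ x ⟨h1, h3.le.trans h2⟩, hφ y ⟨h1.trans h3.le, h2⟩]
    have : f (⟨x, ⟨h1, h3.le.trans h2⟩⟩ : Set.Icc A B) < f ⟨y, ⟨h1.trans h3.le, h2⟩⟩ :=
      f.strictMono (show (⟨x, ⟨h1, h3.le.trans h2⟩⟩ : Set.Icc A B) <
        ⟨y, ⟨h1.trans h3.le, h2⟩⟩ from h3)
    exact this
  · intro x y h1 h2 h3 h4 e
    rw [hφ x ⟨h1, h2⟩, hφ y ⟨h3, h4⟩] at e
    exact congrArg Subtype.val (f.injective (Subtype.ext e))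
  · intro x h1 h2
    rw [hφ x ⟨h1, h2⟩, hrk]
  · intro x h1 h2
    rw [hφ x ⟨h1, h2⟩]
    exact (f ⟨x, h1, h2⟩).2
  · intro x hx
    rw [hφ x (hc.sub x hx)]
    exact hf.subset (Set.mem_image_of_mem f (show (⟨x, hc.sub x hx⟩ : Set.Icc A B) ∈
      (Subtype.val ⁻¹' c : Set (Set.Icc A B)) from hx))

/-- Being in the same orbit, for sets of faces. -/
def SO (P : AbstractPolytope n) (c d : Set P.Face) : Prop :=
  ∃ f : P.Face ≃o P.Face, f '' c = d

theorem SO.symm {c d : Set P.Face} (h : P.SO c d) : P.SO d c := by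
  obtain ⟨f, rfl⟩ := h
  exact ⟨f.symm, by rw [← Set.image_comp]; simp⟩

theorem SO.trans {c d e : Set P.Face} (h : P.SO c d) (h' : P.SO d e) : P.SO c e := by
  obtain ⟨f, rfl⟩ := h
  obtain ⟨g, rfl⟩ := h'
  exact ⟨f.trans g, by rw [← Set.image_comp]; rfl⟩

theorem chiral_not_so (hP : P.IsChiral) {c : Set P.Face} (h : P.IsFl P.bot P.top c)
    {a x b y : P.Face}
    (ha : a ∈ c) (hb : b ∈ c) (hx : x ∈ c) (hr : P.rank b = P.rank a + 2)
    (hax : a < x ∧ x < b) (hay : a < y ∧ y < b) (hne : y ≠ x) :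
    ¬ P.SO c (insert y (c \ {x})) := by
  have h' := h.exchange ha hb hx hr hax hay
  have hy : y ∉ c := fun hy => hne (h.eq hy hx
    ((between_rank hr hay).trans (between_rank hr hax).symm))
  have e1 : c \ (insert y (c \ {x})) = {x} := by
    ext z; simp only [Set.mem_sdiff, Set.mem_insert_iff, Set.mem_singleton_iff]; grind
  have e2 : (insert y (c \ {x})) \ c = {y} := by
    ext z; simp only [Set.mem_sdiff, Set.mem_insert_iff, Set.mem_singleton_iff]; grind
  refine hP.2 h.toFlag h'.toFlag ⟨?_, ?_, ?_⟩
  · intro e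
    have e' : c = insert y (c \ {x}) := congrArg (fun Φ : Flag P.Face => (Φ : Set P.Face)) e
    exact hy (by rw [e']; exact Or.inl rfl)
  · change (c \ (insert y (c \ {x}))).ncard = 1
    rw [e1, Set.ncard_singleton]
  · change ((insert y (c \ {x})) \ c).ncard = 1
    rw [e2, Set.ncard_singleton]

theorem chiral_two (hP : P.IsChiral) {c d e : Set P.Face} (hc : P.IsFl P.bot P.top c)
    (hd : P.IsFl P.bot P.top d) (he : P.IsFl P.bot P.top e) (hcd : ¬ P.SO c d) :
    P.SO c e ∨ P.SO d e := by
  obtain ⟨⟨Φ, Ψ, _, hall⟩, _⟩ := hP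
  have h1 : P.SO c Φ ∨ P.SO c Ψ := hall hc.toFlag
  have h2 : P.SO d Φ ∨ P.SO d Ψ := hall hd.toFlag
  have h3 : P.SO e Φ ∨ P.SO e Ψ := hall he.toFlag
  rcases h1 with h1 | h1 <;> rcases h2 with h2 | h2 <;> rcases h3 with h3 | h3
  all_goals first
    | exact absurd (h1.trans h2.symm) hcd
    | exact Or.inl (h1.trans h3.symm)
    | exact Or.inr (h2.trans h3.symm)

/-- Sections of chiral polytopes which are regular: all base flags are equivalent. -/
theorem exists_isoOn (hP : P.IsChiral) (A B : P.Face) (m : ℕ) (hAB : A ≤ B)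
    (hr : P.rank B = P.rank A + m + 1) (hreg : (sec A B m hAB hr).IsRegular)
    {c d : Set P.Face} (hc : P.IsFl P.bot P.top c) (hd : P.IsFl P.bot P.top d)
    (hA : A ∈ c) (hB : B ∈ c) (j : ℤ) (hj0 : 0 ≤ j) (hjn : j < n) (hjA : j ≠ P.rank A)
    (hjB : j ≠ P.rank B) :
    ∃ φ : P.Face → P.Face, IsoOn φ A B ∧ ∀ x ∈ c, ∀ y ∈ d, P.rank x = P.rank y →
      A ≤ x → x ≤ B → φ x = y := by
  by_cases hcd : P.SO c d
  · obtain ⟨f, rfl⟩ := hcd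
    refine ⟨f, isoOn_aut f A B, fun x hx y hy e _ _ => ?_⟩
    exact hd.eq ⟨x, hx, rfl⟩ hy (by rw [rank_aut, e])
  · have rb := P.rank_bot
    have rt := P.rank_top
    obtain ⟨a, ha, ra⟩ := hc.ranks (j - 1) (by omega) (by omega)
    obtain ⟨x, hx, rx⟩ := hc.ranks j (by omega) (by omega)
    obtain ⟨b, hb, rb'⟩ := hc.ranks (j + 1) (by omega) (by omega)
    have hax : a < x ∧ x < b := ⟨hc.lt ha hx (by omega), hc.lt hx hb (by omega)⟩
    obtain ⟨y, hy, hne⟩ := diamond_exists (by omega) hax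
    have hc' := hc.exchange ha hb hx (by omega) hax hy
    have hn := chiral_not_so hP hc ha hb hx (by omega) hax hy hne
    obtain ⟨f, rfl⟩ := (chiral_two hP hc hc' hd hn).resolve_left hcd
    have hA' : A ∈ insert y (c \ {x}) := Or.inr ⟨hA, by rintro rfl; omega⟩
    have hB' : B ∈ insert y (c \ {x}) := Or.inr ⟨hB, by rintro rfl; omega⟩
    obtain ⟨φ, hφ, hmap, hφc⟩ := exists_isoOn_of_regular A B m hAB hr hreg
      (hc.restrict hA hB hAB) (hc'.restrict hA' hB' hAB)
    refine ⟨fun x => f (φ x), (isoOn_aut f P.bot P.top).comp hφ (P.bot_le _) (P.le_top _), ?_⟩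
    intro z hz w hw e h1 h2
    refine hd.eq ⟨φ z, (hφc z ⟨hz, h1, h2⟩).1, rfl⟩ hw ?_
    rw [rank_aut, hφ.rank z h1 h2, e]

end Sections

end AbstractPolytope
namespace AbstractPolytope

section Main

variable {n : ℕ} {P : AbstractPolytope n}

/-- Hypotheses on `P` used in the proof. -/
structure Good (P : AbstractPolytope n) : Prop where
  hn : 3 ≤ n
  chiral : P.IsChiral
  regF : ∀ (F : P.Face) (hr : P.rank F = P.rank P.bot + (n - 1 : ℕ) + 1),
    (sec P.bot F (n - 1) (P.bot_le F) hr).IsRegular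
  regV : ∀ (v : P.Face) (hr : P.rank P.top = P.rank v + (n - 1 : ℕ) + 1),
    (sec v P.top (n - 1) (P.le_top v) hr).IsRegular
  flat : ∀ F R u : P.Face, P.rank F = n - 1 → P.rank R = n - 2 → P.rank u = 0 →
    R ≤ F → u ≤ F → u ≤ R

theorem Good.flat_all (h : Good P) {u R : P.Face} (hu : P.rank u = 0)
    (hR : P.rank R = n - 2) : u ≤ R := by
  have hn := h.hn
  have rb := P.rank_bot
  have rt := P.rank_top
  obtain ⟨c1, h1⟩ := exists_isFl (P.bot_le u)
  obtain ⟨c2, h2⟩ := exists_isFl (P.le_top u)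
  obtain ⟨d1, k1⟩ := exists_isFl (P.bot_le R)
  obtain ⟨d2, k2⟩ := exists_isFl (P.le_top R)
  have hc := h1.union h2
  refine flag_induction (P.bot_le P.top)
    (fun d => ∀ y ∈ d, (n : ℤ) - 2 ≤ P.rank y → u ≤ y) hc ?_ ?_ (k1.union k2) R
    (Or.inl k1.right) hR.ge
  · intro y hy hr
    exact hc.le (Or.inl h1.right) hy (by omega)
  · rintro d d' hd hd' ih ⟨j, hj⟩ y hy hr
    have t1 := P.rank_mono (P.le_top y)
    obtain ⟨y0, hy0, e0⟩ := hd.ranks (P.rank y) (P.rank_mono (P.bot_le y)) t1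
    by_cases e : P.rank y0 = j
    swap
    · rw [← hd'.eq (hj y0 hy0 e) hy e0]
      exact ih y0 hy0 (by omega)
    by_cases r1 : P.rank y = n - 2
    · obtain ⟨F, hF, rF⟩ := hd.ranks (n - 1) (by omega) (by omega)
      have hF' := hj F hF (by omega)
      exact h.flat F y u rF r1 hu (hd'.le hy hF' (by omega)) (ih F hF (by omega))
    · obtain ⟨R, hR, rR⟩ := hd.ranks (n - 2) (by omega) (by omega)
      have hR' := hj R hR (by omega)
      exact (ih R hR (by omega)).trans (hd'.le hR' hy (by omega))

/-- The base data: a ridge and the two facets containing it. -/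
structure Base (R F F' : P.Face) : Prop where
  rR : P.rank R = n - 2
  rF : P.rank F = n - 1
  rF' : P.rank F' = n - 1
  ne : F' ≠ F
  lt : R < F
  lt' : R < F'

theorem Base.symm {R F F' : P.Face} (b : Base R F F') : Base R F' F :=
  ⟨b.rR, b.rF', b.rF, b.ne.symm, b.lt', b.lt⟩

theorem Base.F_lt {R F F' : P.Face} (b : Base R F F') : F < P.top :=
  P.lt_of_le_rank (P.le_top _) (by rw [b.rF, P.rank_top]; omega)

theorem Base.rtop {R F F' : P.Face} (b : Base R F F') : P.rank P.top = P.rank R + 2 := by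
  rw [b.rR, P.rank_top]; omega

/-- a flag through a given face below `R`, `R` and `F`. -/
theorem Base.exists_flag {R F F' u : P.Face} (b : Base R F F') (hu : u ≤ R) :
    ∃ c, P.IsFl P.bot P.top c ∧ u ∈ c ∧ R ∈ c ∧ F ∈ c := by
  obtain ⟨c1, h1⟩ := exists_isFl (P.bot_le u)
  obtain ⟨c2, h2⟩ := exists_isFl hu
  obtain ⟨c3, h3⟩ := exists_isFl b.lt.le
  obtain ⟨c4, h4⟩ := exists_isFl b.F_lt.le
  exact ⟨_, ((h1.union h2).union h3).union h4, Or.inl (Or.inl (Or.inl h1.right)),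
    Or.inl (Or.inr h3.left), Or.inr h4.left⟩

theorem Base.exch {R F F' : P.Face} (b : Base R F F') {c : Set P.Face}
    (hc : P.IsFl P.bot P.top c) (hR : R ∈ c) (hF : F ∈ c) :
    P.IsFl P.bot P.top (insert F' (c \ {F})) :=
  hc.exchange hR hc.right hF b.rtop ⟨b.lt, b.F_lt⟩ ⟨b.lt', b.symm.F_lt⟩

/-- `φ` is the reflection in `R` of the vertex-figure at `u`. -/
structure Rfl (R F F' : P.Face) (φ : P.Face → P.Face) (u : P.Face) : Prop where
  iso : IsoOn φ u P.top
  fix : ∀ x, u ≤ x → x ≤ R → φ x = x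
  swap : φ F = F'
  swap' : φ F' = F

theorem Rfl.symm {R F F' : P.Face} {φ : P.Face → P.Face} {u : P.Face} (h : Rfl R F F' φ u) :
    Rfl R F' F φ u := ⟨h.iso, h.fix, h.swap', h.swap⟩

theorem isoOn_top {φ : P.Face → P.Face} {u : P.Face} (h : IsoOn φ u P.top) :
    φ P.top = P.top :=
  P.eq_of_le_rank (P.le_top _) (h.rank _ (P.le_top _) le_rfl).ge

theorem Good.exists_rfl (h : Good P) {R F F' u : P.Face} (b : Base R F F')
    (hu : P.rank u = 0) : ∃ φ, Rfl R F F' φ u := by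
  have hn := h.hn
  have rt := P.rank_top
  have rR := b.rR
  have rF := b.rF
  have rF' := b.rF'
  have huR := h.flat_all hu b.rR
  obtain ⟨c, hc, huc, hRc, hFc⟩ := b.exists_flag huR
  have hd := b.exch hc hRc hFc
  have hr : P.rank P.top = P.rank u + (n - 1 : ℕ) + 1 := by omega
  obtain ⟨φ, hφ, hcd⟩ := exists_isoOn h.chiral u P.top (n - 1) (P.le_top u) hr (h.regV u hr)
    hc hd huc hc.right (n - 1) (by omega) (by omega) (by omega) (by omega)
  have hsw : φ F = F' := hcd F hFc F' (Or.inl rfl) (by omega) (huR.trans b.lt.le) (P.le_top _)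
  have hfix : ∀ x, u ≤ x → x ≤ R → φ x = x := by
    refine (hφ.mono le_rfl (P.le_top R)).rigid (isoOn_id u R) (hc.restrict huc hRc huR) ?_
    rintro x ⟨hx, h1, h2⟩
    exact hcd x hx x (Or.inr ⟨hx, fun e => absurd (e ▸ h2) (not_le_of_gt b.lt)⟩) rfl h1
      (P.le_top _)
  refine ⟨φ, hφ, hfix, hsw, ?_⟩
  have e1 : φ R = R := hfix R huR le_rfl
  have e2 := isoOn_top hφ
  refine diamond_eq (A := R) (B := P.top) (x := F') b.rtop ⟨b.lt', b.symm.F_lt⟩ ?_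
    ⟨b.lt, b.F_lt⟩ ?_ b.ne.symm
  · have l1 := hφ.lt R F' huR (P.le_top _) b.lt'
    have l2 := hφ.lt F' P.top (huR.trans b.lt'.le) le_rfl b.symm.F_lt
    rw [e1] at l1
    rw [e2] at l2
    exact ⟨l1, l2⟩
  · intro e
    exact b.ne (hφ.inj _ _ (huR.trans b.lt'.le) (P.le_top _) (huR.trans b.lt.le) (P.le_top _)
      (e.trans hsw.symm))

theorem Good.exists_facetIso (h : Good P) {R F F' : P.Face} (b : Base R F F') :
    ∃ φ, IsoOn φ P.bot F ∧ (∀ x, x ≤ R → φ x = x) ∧ φ F = F' := by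
  have hn := h.hn
  have rb := P.rank_bot
  have rR := b.rR
  have rF := b.rF
  have rF' := b.rF'
  obtain ⟨c, hc, -, hRc, hFc⟩ := b.exists_flag (le_refl R)
  have hd := b.exch hc hRc hFc
  have hr : P.rank F = P.rank P.bot + (n - 1 : ℕ) + 1 := by omega
  obtain ⟨φ, hφ, hcd⟩ := exists_isoOn h.chiral P.bot F (n - 1) (P.bot_le F) hr (h.regF F hr)
    hc hd hc.left hFc 0 (by omega) (by omega) (by omega) (by omega)
  have hsw : φ F = F' := hcd F hFc F' (Or.inl rfl) (by omega) (P.bot_le _) le_rfl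
  refine ⟨φ, hφ, fun x hx => ?_, hsw⟩
  refine (hφ.mono le_rfl b.lt.le).rigid (isoOn_id P.bot R)
    (hc.restrict hc.left hRc (P.bot_le _)) ?_ x (P.bot_le _) hx
  rintro x ⟨hx, h1, h2⟩
  exact hcd x hx x (Or.inr ⟨hx, fun e => absurd (e ▸ h2) (not_le_of_gt b.lt)⟩) rfl h1
    (h2.trans b.lt.le)

/-- The key step. -/
theorem Good.step (h : Good P) {R F F' : P.Face} (b : Base R F F')
    (f : P.Face → P.Face → P.Face) (hf : ∀ u, P.rank u = 0 → Rfl R F F' (f u) u)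
    {S R' : P.Face} (rS : P.rank S = n - 3) (hSR : S < R) (hSR' : S < R') (hR'F : R' < F)
    (hne : R' ≠ R) :
    ∃ g : P.Face ≃o P.Face, g R = R' ∧ ∀ u, P.rank u = 0 → ∀ x, u ≤ x →
      f (g u) (g x) = g.symm (f u x) := by
  have hn := h.hn
  have rR := b.rR
  have rF := b.rF
  have rF' := b.rF'
  have rFS : P.rank F = P.rank S + 2 := by omega
  have rFS' : P.rank F' = P.rank S + 2 := by omega
  have rR' : P.rank R' = n - 2 := by
    have := between_rank rFS ⟨hSR', hR'F⟩
    omega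
  obtain ⟨c, hc, hSc, hRc, hFc⟩ := b.exists_flag hSR.le
  have hd1 := b.exch hc hRc hFc
  have hd2 := hc.exchange hSc hFc hRc rFS ⟨hSR, b.lt⟩ ⟨hSR', hR'F⟩
  have n1 := chiral_not_so h.chiral hc hRc hc.right hFc b.rtop ⟨b.lt, b.F_lt⟩
    ⟨b.lt', b.symm.F_lt⟩ b.ne
  have n2 := chiral_not_so h.chiral hc hSc hFc hRc rFS ⟨hSR, b.lt⟩ ⟨hSR', hR'F⟩ hne
  obtain ⟨g, hg⟩ : P.SO (insert F' (c \ {F})) (insert R' (c \ {R})) :=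
    (chiral_two h.chiral hc hd1 hd2 n1).resolve_left n2
  have hgm : ∀ x ∈ insert F' (c \ {F}), ∀ y ∈ insert R' (c \ {R}), P.rank x = P.rank y →
      g x = y := by
    intro x hx y hy e
    refine hd2.eq ?_ hy (by rw [rank_aut, e])
    rw [← hg]
    exact ⟨x, hx, rfl⟩
  have gR : g R = R' := hgm R (Or.inr ⟨hRc, b.lt.ne⟩) R' (Or.inl rfl) (by omega)
  have gF' : g F' = F := hgm F' (Or.inl rfl) F (Or.inr ⟨hFc, b.lt.ne'⟩) (by omega)
  have gfix : ∀ x ∈ c, P.rank x ≤ n - 3 → g x = x := by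
    intro x hx hr
    refine hgm x (Or.inr ⟨hx, ?_⟩) x (Or.inr ⟨hx, ?_⟩) rfl
    · rintro rfl; omega
    · rintro rfl; omega
  have gS : g S = S := gfix S hSc rS.le
  have gF : g.symm F = F' := by rw [← gF', g.symm_apply_apply]
  have gS' : g.symm S = S := by rw [g.symm_apply_eq, gS]
  obtain ⟨φ, hφ, φfix, φF⟩ := h.exists_facetIso b
  -- on the ridge `R`, the map `φ ∘ g` is the inverse of `g`
  have φR' : φ R' = g.symm R := by
    have φS : φ S = S := φfix S hSR.le
    refine diamond_eq (A := S) (B := F') (x := R) rFS' ⟨hSR, b.lt'⟩ ?_ ?_ ?_ ?_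
    · have l1 := hφ.lt S R' (P.bot_le _) hR'F.le hSR'
      have l2 := hφ.lt R' F (P.bot_le _) le_rfl hR'F
      rw [φS] at l1
      rw [φF] at l2
      exact ⟨l1, l2⟩
    · have l1 := g.symm.strictMono hSR
      have l2 := g.symm.strictMono b.lt
      rw [gS'] at l1
      rw [gF] at l2
      exact ⟨l1, l2⟩
    · intro e
      refine hne (hφ.inj _ _ (P.bot_le _) hR'F.le (P.bot_le _) b.lt.le ?_)
      rw [e, φfix R le_rfl]
    · intro e
      rw [g.symm_apply_eq, gR] at e
      exact hne e.symm
  have key : ∀ x, x ≤ R → φ (g x) = g.symm x := by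
    intro x hx
    refine IsoOn.rigid (φ := fun x => φ (g x)) (ψ := g.symm)
      (hφ.comp (isoOn_aut g P.bot R) (P.bot_le _) (gR ▸ hR'F.le)) (isoOn_aut g.symm P.bot R)
      (hc.restrict hc.left hRc (P.bot_le _)) ?_ x (P.bot_le _) hx
    rintro y ⟨hy, -, hyR⟩
    by_cases e : y = R
    · rw [e, gR, φR']
    · have hlt := P.rank_strictMono _ _ (lt_of_le_of_ne hyR e)
      have e1 := gfix y hy (by omega)
      rw [e1, φfix y hyR, eq_comm, g.symm_apply_eq, e1]
  -- the reflections agree with `φ` on the facet `F`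
  have agree : ∀ w, P.rank w = 0 → ∀ x, w ≤ x → x ≤ F → f w x = φ x := by
    intro w hw x h1 h2
    have hwR := h.flat_all hw b.rR
    have hwf := hf w hw
    obtain ⟨e, he, hwe, hRe, hFe⟩ := b.exists_flag hwR
    refine (hwf.iso.mono le_rfl (P.le_top F)).rigid (hφ.mono (P.bot_le w) le_rfl)
      (he.restrict hwe hFe (hwR.trans b.lt.le)) ?_ x h1 h2
    rintro y ⟨hy, h3, h4⟩
    rcases he.chain y hy R hRe with h5 | h5
    · rw [hwf.fix y h3 h5, φfix y h5]
    · by_cases e1 : y = R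
      · subst e1
        rw [hwf.fix y h3 le_rfl, φfix y le_rfl]
      · have : y = F := he.eq hy hFe (by
          have a1 := P.rank_strictMono _ _ (lt_of_le_of_ne h5 (Ne.symm e1))
          have a2 := P.rank_mono h4
          omega)
        rw [this, hwf.swap, φF]
  refine ⟨g, gR, fun u hu x hux => ?_⟩
  have huR := h.flat_all hu b.rR
  have hgu : P.rank (g u) = 0 := by rw [rank_aut, hu]
  have hguR := h.flat_all hgu b.rR
  have eu : g u = g.symm u := by rw [← key u huR, φfix _ hguR]
  have hfu := hf u hu
  have hfg := hf (g u) hgu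
  obtain ⟨e, he, hue, hRe, hFe⟩ := b.symm.exists_flag huR
  refine IsoOn.rigid (φ := fun x => f (g u) (g x)) (ψ := fun x => g.symm (f u x))
    (hfg.iso.comp (isoOn_aut g u P.top) le_rfl (P.le_top _))
    ((isoOn_aut g.symm P.bot P.top).comp hfu.iso (P.bot_le _) (P.le_top _))
    (he.restrict hue he.right (P.le_top u)) ?_ x hux (P.le_top x)
  rintro y ⟨hy, h1, -⟩
  rcases he.chain y hy R hRe with h5 | h5
  · have h6 : g y ≤ F := (gR ▸ g.monotone h5 : g y ≤ R').trans hR'F.le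
    rw [agree (g u) hgu (g y) (g.monotone h1) h6, key y h5, hfu.fix y h1 h5]
  · by_cases e1 : y = R
    · subst e1
      rw [agree (g u) hgu (g y) (g.monotone h1) (gR ▸ hR'F.le), key y le_rfl,
        hfu.fix y h1 le_rfl]
    · have a1 := P.rank_strictMono _ _ (lt_of_le_of_ne h5 (Ne.symm e1))
      have a2 := P.rank_mono (P.le_top y)
      rw [P.rank_top] at a2
      by_cases e2 : P.rank y = n - 1
      · have : y = F' := he.eq hy hFe (by omega)
        rw [this, gF', hfg.swap, hfu.swap', gF]
      · have : y = P.top := he.eq hy he.right (by rw [P.rank_top]; omega)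
        rw [this, aut_top, isoOn_top hfg.iso, isoOn_top hfu.iso, aut_top]

theorem Good.ridge_trans (h : Good P) {R F F' : P.Face} (b : Base R F F')
    (f : P.Face → P.Face → P.Face) (hf : ∀ u, P.rank u = 0 → Rfl R F F' (f u) u)
    {R1 : P.Face} (hR1 : P.rank R1 = n - 2) :
    ∃ k k' : P.Face ≃o P.Face, k R = R1 ∧ ∀ u, P.rank u = 0 → ∀ x, u ≤ x →
      f (k u) (k x) = k' (f u x) := by
  have hn := h.hn
  have rb := P.rank_bot
  have rt := P.rank_top
  obtain ⟨c, hc, -, hRc, -⟩ := b.exists_flag (le_refl R)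
  obtain ⟨d1, k1⟩ := exists_isFl (P.bot_le R1)
  obtain ⟨d2, k2⟩ := exists_isFl (P.le_top R1)
  refine flag_induction (P.bot_le P.top)
    (fun d => ∀ y ∈ d, P.rank y = n - 2 → ∃ k k' : P.Face ≃o P.Face, k R = y ∧
      ∀ u, P.rank u = 0 → ∀ x, u ≤ x → f (k u) (k x) = k' (f u x)) hc ?_ ?_
    (k1.union k2) R1 (Or.inl k1.right) hR1
  · intro y hy ry
    have : y = R := hc.eq hy hRc (by rw [ry, b.rR])
    subst this
    exact ⟨OrderIso.refl _, OrderIso.refl _, rfl, fun _ _ _ _ => rfl⟩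
  · rintro d d' hd hd' ih ⟨j, hj⟩ y hy ry
    obtain ⟨y0, hy0, e0⟩ := hd.ranks (P.rank y) (P.rank_mono (P.bot_le y))
      (P.rank_mono (P.le_top y))
    by_cases e : y = y0
    · subst e
      exact ih y hy0 ry
    have ej : P.rank y0 = j := by
      by_contra e'
      exact e (hd'.eq hy (hj y0 hy0 e') e0.symm)
    obtain ⟨k, k', hk, hkk⟩ := ih y0 hy0 (by omega)
    obtain ⟨S, hS, rS⟩ := hd.ranks (n - 3) (by omega) (by omega)
    obtain ⟨G, hG, rG⟩ := hd.ranks (n - 1) (by omega) (by omega)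
    have hS' := hj S hS (by omega)
    have hG' := hj G hG (by omega)
    have l1 := hd.lt hS hy0 (by omega)
    have l2 := hd.lt hy0 hG (by omega)
    have l3 := hd'.lt hS' hy (by omega)
    have l4 := hd'.lt hy hG' (by omega)
    have hkR : k.symm y0 = R := by rw [← hk, k.symm_apply_apply]
    have m1 := k.symm.strictMono l1
    have m2 := k.symm.strictMono l2
    have m3 := k.symm.strictMono l3
    have m4 := k.symm.strictMono l4
    rw [hkR] at m1 m2
    have rG' : P.rank (k.symm G) = n - 1 := by rw [rank_aut, rG]
    have rS' : P.rank (k.symm S) = n - 3 := by rw [rank_aut, rS]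
    have ne' : k.symm y ≠ R := fun e1 => e (k.symm.injective (e1.trans hkR.symm))
    have hGF : k.symm G = F ∨ k.symm G = F' := by
      by_contra hcon
      push Not at hcon
      refine hcon.2 ?_
      refine diamond_eq b.rtop ⟨b.lt, b.F_lt⟩ ⟨m2, ?_⟩ ⟨b.lt', b.symm.F_lt⟩ hcon.1 b.ne
      exact P.lt_of_le_rank (P.le_top _) (by omega)
    have : ∃ g : P.Face ≃o P.Face, g R = k.symm y ∧ ∀ u, P.rank u = 0 → ∀ x, u ≤ x →
        f (g u) (g x) = g.symm (f u x) := by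
      rcases hGF with e1 | e1
      · rw [e1] at m4
        exact h.step b f hf rS' m1 m3 m4 ne'
      · rw [e1] at m4
        exact h.step b.symm f (fun u hu => (hf u hu).symm) rS' m1 m3 m4 ne'
    obtain ⟨g, hg, hgg⟩ := this
    refine ⟨g.trans k, g.symm.trans k', ?_, ?_⟩
    · simp [hg]
    · intro u hu x hux
      change f (k (g u)) (k (g x)) = k' (g.symm (f u x))
      rw [hkk (g u) (by rw [rank_aut, hu]) (g x) (g.monotone hux), hgg u hu x hux]

theorem Good.indep (h : Good P) {R F F' : P.Face} (b : Base R F F')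
    (f : P.Face → P.Face → P.Face) (hf : ∀ u, P.rank u = 0 → Rfl R F F' (f u) u)
    {G v w : P.Face} (hv : P.rank v = 0) (hw : P.rank w = 0) (hvG : v ≤ G) (hwG : w ≤ G) :
    f v G = f w G := by
  have hn := h.hn
  have rb := P.rank_bot
  have rt := P.rank_top
  obtain ⟨d1, k1⟩ := exists_isFl (P.bot_le G)
  obtain ⟨d2, k2⟩ := exists_isFl (P.le_top G)
  have hd := k1.union k2
  obtain ⟨R1, hR1, rR1⟩ := hd.ranks (n - 2) (by omega) (by omega)
  obtain ⟨k, k', hk, hkk⟩ := h.ridge_trans b f hf rR1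
  have main : ∀ u, P.rank u = 0 → u ≤ G → f u G = k' (f (k.symm u) (k.symm G)) := by
    intro u hu huG
    rw [← hkk (k.symm u) (by rw [rank_aut, hu]) (k.symm G) (k.symm.monotone huG)]
    simp
  rw [main v hv hvG, main w hw hwG]
  congr 1
  have hkR : k.symm R1 = R := by rw [← hk, k.symm_apply_apply]
  have hv' := hf (k.symm v) (by rw [rank_aut, hv])
  have hw' := hf (k.symm w) (by rw [rank_aut, hw])
  have v1 := k.symm.monotone hvG
  have w1 := k.symm.monotone hwG
  rcases hd.chain G (Or.inl k1.right) R1 hR1 with h1 | h1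
  · have h2 := k.symm.monotone h1
    rw [hkR] at h2
    rw [hv'.fix _ v1 h2, hw'.fix _ w1 h2]
  · have h2 := k.symm.monotone h1
    rw [hkR] at h2
    generalize k.symm G = G0 at *
    rcases eq_or_lt_of_le h2 with rfl | h3
    · rw [hv'.fix _ v1 le_rfl, hw'.fix _ w1 le_rfl]
    rcases eq_or_lt_of_le (P.le_top G0) with rfl | h4
    · rw [isoOn_top hv'.iso, isoOn_top hw'.iso]
    by_cases e : G0 = F
    · rw [e, hv'.swap, hw'.swap]
    · have : G0 = F' := diamond_eq b.rtop ⟨b.lt, b.F_lt⟩ ⟨h3, h4⟩ ⟨b.lt', b.symm.F_lt⟩ e b.ne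
      rw [this, hv'.swap', hw'.swap']

theorem Good.rfl_invol (h : Good P) {R F F' : P.Face} (b : Base R F F')
    {φ : P.Face → P.Face} {u : P.Face} (hu : P.rank u = 0) (hφ : Rfl R F F' φ u) :
    ∀ x, u ≤ x → φ (φ x) = x := by
  have rR := b.rR
  have rF := b.rF
  have rt := P.rank_top
  have huR := h.flat_all hu b.rR
  obtain ⟨e, he, hue, hRe, hFe⟩ := b.exists_flag huR
  have h0 : φ u = u := hφ.fix u le_rfl huR
  intro x hx
  refine IsoOn.rigid (φ := fun x => φ (φ x)) (ψ := fun x => x)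
    (hφ.iso.comp hφ.iso h0.ge (P.le_top _)) (isoOn_id u P.top)
    (he.restrict hue he.right (P.le_top u)) ?_ x hx (P.le_top x)
  rintro y ⟨hy, h1, -⟩
  change φ (φ y) = y
  by_cases hyR : P.rank y ≤ P.rank R
  · have h2 := hφ.fix y h1 (he.le hy hRe hyR)
    rw [h2, h2]
  · have a2 := P.rank_mono (P.le_top y)
    by_cases e2 : P.rank y = n - 1
    · have : y = F := he.eq hy hFe (by omega)
      rw [this, hφ.swap, hφ.swap']
    · have : y = P.top := he.eq hy he.right (by omega)
      rw [this, isoOn_top hφ.iso, isoOn_top hφ.iso]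

theorem Good.false (h : Good P) : False := by
  have hn := h.hn
  have rb := P.rank_bot
  have rt := P.rank_top
  obtain ⟨c, hc⟩ := exists_isFl (P.bot_le P.top)
  obtain ⟨R, hR, rR⟩ := hc.ranks (n - 2) (by omega) (by omega)
  obtain ⟨F, hF, rF⟩ := hc.ranks (n - 1) (by omega) (by omega)
  have l1 := hc.lt hR hF (by omega)
  have l2 := hc.lt hF hc.right (by omega)
  obtain ⟨F', hF', hne⟩ := diamond_exists (A := R) (B := P.top) (by omega) ⟨l1, l2⟩
  have rF' := between_rank (by omega) hF'
  have b : Base R F F' := ⟨rR, rF, by omega, hne, l1, hF'.1⟩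
  have ex : ∀ u : P.Face, ∃ φ, P.rank u = 0 → Rfl R F F' φ u := by
    intro u
    by_cases hu : P.rank u = 0
    · obtain ⟨φ, hφ⟩ := h.exists_rfl b hu
      exact ⟨φ, fun _ => hφ⟩
    · exact ⟨id, fun h => absurd h hu⟩
  choose f hf using ex
  have exv : ∀ G : P.Face, ∃ v, G ≠ P.bot → P.rank v = 0 ∧ v ≤ G := by
    intro G
    by_cases hG : G = P.bot
    · exact ⟨G, fun h => absurd hG h⟩
    · obtain ⟨e, he⟩ := exists_isFl (P.bot_le G)
      have := P.rank_strictMono _ _ (lt_of_le_of_ne (P.bot_le G) (Ne.symm hG))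
      obtain ⟨v, hv, rv⟩ := he.ranks 0 (by omega) (by omega)
      exact ⟨v, fun _ => ⟨rv, (he.sub v hv).2⟩⟩
  choose v hv using exv
  let t : P.Face → P.Face := fun G => if G = P.bot then P.bot else f (v G) G
  have tbot : t P.bot = P.bot := if_pos rfl
  have tval : ∀ u G, P.rank u = 0 → u ≤ G → t G = f u G := by
    intro u G hu huG
    have hG : G ≠ P.bot := by
      rintro rfl
      have := P.rank_mono huG
      omega
    have : t G = f (v G) G := if_neg hG
    rw [this]
    exact h.indep b f hf (hv G hG).1 hu (hv G hG).2 huG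
  have tinv : Function.Involutive t := by
    intro G
    by_cases hG : G = P.bot
    · rw [hG, tbot, tbot]
    · obtain ⟨h1, h2⟩ := hv G hG
      have hr := hf _ h1
      have h3 : v G ≤ f (v G) G := by
        have := hr.iso.le le_rfl (P.le_top G) h2
        rwa [hr.fix _ le_rfl (h.flat_all h1 rR)] at this
      rw [tval _ G h1 h2, tval _ _ h1 h3, h.rfl_invol b h1 hr _ h2]
  have tmono : ∀ G G', G ≤ G' → t G ≤ t G' := by
    intro G G' hGG
    by_cases hG : G = P.bot
    · rw [hG, tbot]; exact P.bot_le _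
    · obtain ⟨h1, h2⟩ := hv G hG
      rw [tval _ G h1 h2, tval _ G' h1 (h2.trans hGG)]
      exact (hf _ h1).iso.le h2 (P.le_top _) hGG
  let T : P.Face ≃o P.Face :=
    { toEquiv := tinv.toPerm
      map_rel_iff' := by
        intro G G'
        refine ⟨fun hle => ?_, tmono G G'⟩
        have := tmono _ _ hle
        change t (t G) ≤ t (t G') at this
        rwa [tinv, tinv] at this }
  have hT : ∀ G, T G = t G := fun _ => rfl
  refine chiral_not_so h.chiral hc hR hc.right hF (by omega) ⟨l1, l2⟩ hF' hne ⟨T, ?_⟩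
  have hd := b.exch hc hR hF
  have hTc : P.IsFl P.bot P.top (T '' c) := by
    refine ⟨⟨_, hc.left, aut_bot T⟩, ⟨_, hc.right, aut_top T⟩,
      fun x _ => ⟨P.bot_le x, P.le_top x⟩, ?_, ?_⟩
    · rintro _ ⟨x, hx, rfl⟩ _ ⟨y, hy, rfl⟩
      exact (hc.chain x hx y hy).imp (fun h => T.monotone h) (fun h => T.monotone h)
    · intro j h1 h2
      obtain ⟨x, hx, e⟩ := hc.ranks j h1 h2
      exact ⟨T x, ⟨x, hx, rfl⟩, by rw [rank_aut, e]⟩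
  refine hTc.eq_of_subset hd ?_
  rintro _ ⟨x, hx, rfl⟩
  rw [hT]
  obtain ⟨u, hu, ru⟩ := hc.ranks 0 (by omega) (by omega)
  have huf := hf u ru
  by_cases hxF : x = F
  · left
    rw [hxF, tval u F ru (hc.le hu hF (by omega)), huf.swap]
  · right
    have : t x = x := by
      by_cases hxb : x = P.bot
      · rw [hxb, tbot]
      have r0 := P.rank_strictMono _ _ (lt_of_le_of_ne (P.bot_le x) (Ne.symm hxb))
      have hux := hc.le hu hx (by omega)
      rw [tval u x ru hux]
      by_cases hxR : P.rank x ≤ n - 2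
      · exact huf.fix x hux (hc.le hx hR (by omega))
      · have a2 := P.rank_mono (P.le_top x)
        have a3 : P.rank x ≠ n - 1 := fun e => hxF (hc.eq hx hF (by omega))
        have : x = P.top := hc.eq hx hc.right (by omega)
        rw [this, isoOn_top huf.iso]
    rw [this]
    exact ⟨hx, hxF⟩

end Main

end AbstractPolytope
/-- There is no chiral polytope with flat, finite, regular facets
and finite regular vertex-figures: if `P` is a chiral `n`-polytope (`n ≥ 3`) all of
whose facets are finite regular flat `(n-1)`-polytopes, then the vertex-figures of
`P` cannot all be finite regular `(n-1)`-polytopes. -/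
theorem chiral_no_flat_regular_facets
    (n : ℕ) (hn : 3 ≤ n) (P : AbstractPolytope n) (hchiral : P.IsChiral)
    (hfacets : ∀ (F : P.Face) (Q : AbstractPolytope (n - 1)),
      P.IsFacet F → P.IsSection Q P.bot F →
        Finite Q.Face ∧ Q.IsRegular ∧ Q.IsFlat) :
    ¬ ∀ (v : P.Face) (Q : AbstractPolytope (n - 1)),
        P.IsVertex v → P.IsSection Q v P.top →
          Finite Q.Face ∧ Q.IsRegular := by
  intro hvert
  have rb := P.rank_bot
  have rt := P.rank_top
  refine AbstractPolytope.Good.false (P := P) ⟨hn, hchiral, ?_, ?_, ?_⟩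
  · intro F hr
    refine (hfacets F _ ?_ (AbstractPolytope.isSection_sec P.bot F (n - 1) (P.bot_le F) hr)).2.1
    change P.rank F = n - 1
    omega
  · intro v hr
    refine (hvert v _ ?_ (AbstractPolytope.isSection_sec v P.top (n - 1) (P.le_top v) hr)).2
    change P.rank v = 0
    omega
  · intro F R u rF rR ru hRF huF
    have hr : P.rank F = P.rank P.bot + (n - 1 : ℕ) + 1 := by omega
    have hfl := (hfacets F _ rF
      (AbstractPolytope.isSection_sec P.bot F (n - 1) (P.bot_le F) hr)).2.2
    have h1 := hfl (⟨u, P.bot_le u, huF⟩ : Set.Icc P.bot F) (⟨R, P.bot_le R, hRF⟩ : Set.Icc P.bot F)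
      (show P.rank u - P.rank P.bot - 1 = 0 by omega)
      (show P.rank R - P.rank P.bot - 1 = ((n - 1 : ℕ) : ℤ) - 1 by omega)
    rcases h1 with h1 | h1
    · exact h1
    · have h2 : R ≤ u := h1
      have := P.rank_mono h2
      omega
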